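/- Let n ≥ 1 and let π ∈ S_n be a single n-cycle. Then the number of factorizations of π into the minimal number n − 1 of transpositions equals n^{n−2}. -/

import Mathlib

noncomputable section

/-- The cycle type of a permutation of `{1,…,n}` including parts equal to `1` for fixed points. -/
def fullCycleType {n : ℕ} (π : Equiv.Perm (Fin n)) : Multiset ℕ :=
  π.cycleType + Multiset.replicate (n - π.support.card) 1

/-- The number of factorizations of `π` into `r` transpositions, i.e. sequences
`(τ_1, …, τ_r)` of transpositions with `τ_1 ⋯ τ_r = π`. -/
def swapFactorizationCount (n r : ℕ) (π : Equiv.Perm (Fin n)) : ℕ :=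
  Nat.card {l : List (Equiv.Perm (Fin n)) //
    l.length = r ∧ (∀ τ ∈ l, τ.IsSwap) ∧ l.prod = π}

namespace Equiv.Perm

variable {α : Type*}

theorem SameCycle.of_forall_apply [Finite α] {σ ρ : Perm α}
    (h : ∀ z, σ.SameCycle z (ρ z)) {a b : α}
    (hab : ρ.SameCycle a b) : σ.SameCycle a b := by
  obtain ⟨k, -, rfl⟩ := hab.exists_pow_eq'
  clear hab
  induction k with
  | zero => exact SameCycle.refl _ _
  | succ k ih =>
    rw [pow_succ', mul_apply]
    exact ih.trans (h _)

variable [Fintype α] [DecidableEq α]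

theorem SameCycle.of_mul_swap {σ : Perm α} {x y a b : α} (hxy : σ.SameCycle x y)
    (hab : (σ * swap x y).SameCycle a b) : σ.SameCycle a b := by
  refine SameCycle.of_forall_apply (fun z => ?_) hab
  rw [mul_apply, sameCycle_apply_right]
  by_cases hx : z = x
  · subst hx; simpa using hxy
  by_cases hy : z = y
  · subst hy; simpa using hxy.symm
  rw [swap_apply_of_ne_of_ne hx hy]

theorem sameCycle_mul_swap_of_not_sameCycle {σ : Perm α} {x y : α} (hxy : ¬ σ.SameCycle x y) :
    (σ * swap x y).SameCycle x y := by
  have hne (k : ℕ) : (σ ^ k) y ≠ x := fun h => hxy (SameCycle.symm ⟨k, by simpa using h⟩)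
  have hex : ∃ k : ℕ, (σ ^ (k + 1)) y = y := by
    refine ⟨orderOf σ - 1, ?_⟩
    rw [Nat.sub_add_cancel (orderOf_pos σ), pow_orderOf_eq_one, one_apply]
  have key (k : ℕ) (hk : k ≤ Nat.find hex) :
      ((σ * swap x y) ^ (k + 1)) x = (σ ^ (k + 1)) y := by
    induction k with
    | zero => simp
    | succ k ih =>
      rw [pow_succ', mul_apply, ih (by omega), mul_apply,
        swap_apply_of_ne_of_ne (hne _) (Nat.find_min hex (by omega)), ← mul_apply, ← pow_succ']
  refine ⟨(Nat.find hex + 1 : ℕ), ?_⟩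
  rw [zpow_natCast, key _ le_rfl, Nat.find_spec hex]

theorem sameCycle_mul_swap_iff {σ : Perm α} {x y a b : α} (hxy : ¬ σ.SameCycle x y) :
    (σ * swap x y).SameCycle a b ↔ σ.SameCycle a b ∨
      (σ.SameCycle x a ∨ σ.SameCycle y a) ∧ (σ.SameCycle x b ∨ σ.SameCycle y b) := by
  have hmerge := sameCycle_mul_swap_of_not_sameCycle hxy
  have hmono {a b : α} (h : σ.SameCycle a b) : (σ * swap x y).SameCycle a b :=
    hmerge.of_mul_swap (by rwa [mul_assoc, swap_mul_self, mul_one])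
  constructor
  · intro h
    obtain ⟨k, -, rfl⟩ := h.exists_pow_eq'
    clear h
    induction k with
    | zero => exact Or.inl (SameCycle.refl _ _)
    | succ k ih =>
      rw [pow_succ', mul_apply]
      set c := ((σ * swap x y) ^ k) a
      rw [mul_apply, sameCycle_apply_right, sameCycle_apply_right, sameCycle_apply_right]
      by_cases hx : c = x
      · rw [hx, swap_apply_left]
        rw [hx] at ih
        refine Or.inr ⟨?_, Or.inr (SameCycle.refl _ _)⟩
        exact ih.elim (fun h => Or.inl h.symm) (·.1)
      by_cases hy : c = y
      · rw [hy, swap_apply_right]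
        rw [hy] at ih
        refine Or.inr ⟨?_, Or.inl (SameCycle.refl _ _)⟩
        exact ih.elim (fun h => Or.inr h.symm) (·.1)
      rwa [swap_apply_of_ne_of_ne hx hy]
  · have hsub {c : α} (h : σ.SameCycle x c ∨ σ.SameCycle y c) : (σ * swap x y).SameCycle x c :=
      h.elim hmono fun h => hmerge.trans (hmono h)
    rintro (h | ⟨ha, hb⟩)
    · exact hmono h
    · exact (hsub ha).symm.trans (hsub hb)

/-- The cycle of `σ` through `x`, as a finite set. -/
def orbitFinset (σ : Perm α) (x : α) : Finset α := {y | σ.SameCycle x y}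

/-- The set of cycles of `σ`, fixed points included. -/
def orbits (σ : Perm α) : Finset (Finset α) := Finset.univ.image σ.orbitFinset

@[simp]
theorem mem_orbitFinset {σ : Perm α} {x y : α} : y ∈ σ.orbitFinset x ↔ σ.SameCycle x y := by
  simp [orbitFinset]

theorem orbitFinset_eq_iff {σ : Perm α} {x y : α} :
    σ.orbitFinset x = σ.orbitFinset y ↔ σ.SameCycle x y := by
  constructor
  · intro h
    rw [← mem_orbitFinset, h, mem_orbitFinset]
  · intro h
    ext z
    simp only [mem_orbitFinset]
    exact ⟨h.symm.trans, h.trans⟩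

theorem card_orbitFinset_pos (σ : Perm α) (x : α) : 0 < (σ.orbitFinset x).card :=
  Finset.card_pos.2 ⟨x, by simp [SameCycle.refl]⟩

theorem sum_inv_card_orbitFinset (σ : Perm α) :
    ∑ x, ((σ.orbitFinset x).card : ℚ)⁻¹ = σ.orbits.card := by
  rw [Finset.sum_comp (fun s : Finset α => (s.card : ℚ)⁻¹) σ.orbitFinset, Finset.cast_card]
  refine Finset.sum_congr rfl fun s hs => ?_
  obtain ⟨x, -, rfl⟩ := Finset.mem_image.1 hs
  have : ({a | σ.orbitFinset a = σ.orbitFinset x} : Finset α) = σ.orbitFinset x := by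
    ext a
    simp [orbitFinset_eq_iff, sameCycle_comm]
  rw [this, nsmul_eq_mul, mul_inv_cancel₀]
  exact_mod_cast (card_orbitFinset_pos σ x).ne'

theorem card_orbits_le_card_orbits {σ ρ : Perm α}
    (h : ∀ a b, ρ.SameCycle a b → σ.SameCycle a b) : σ.orbits.card ≤ ρ.orbits.card := by
  rw [← Nat.cast_le (α := ℚ), ← sum_inv_card_orbitFinset, ← sum_inv_card_orbitFinset]
  refine Finset.sum_le_sum fun x _ => ?_
  have := card_orbitFinset_pos ρ x
  gcongr
  intro y hy
  simp only [mem_orbitFinset] at hy ⊢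
  exact h _ _ hy

theorem orbitFinset_mul_swap {σ : Perm α} {x y : α} (hxy : ¬ σ.SameCycle x y) (z : α) :
    (σ * swap x y).orbitFinset z = if σ.SameCycle x z ∨ σ.SameCycle y z then
      σ.orbitFinset x ∪ σ.orbitFinset y else σ.orbitFinset z := by
  ext w
  split_ifs with h
  · simp only [mem_orbitFinset, sameCycle_mul_swap_iff hxy, h, true_and, Finset.mem_union,
      or_iff_right_iff_imp]
    exact fun hzw => h.imp (·.trans hzw) (·.trans hzw)
  · simp [sameCycle_mul_swap_iff hxy, h]

theorem orbits_mul_swap {σ : Perm α} {x y : α} (hxy : ¬ σ.SameCycle x y) :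
    (σ * swap x y).orbits = insert (σ.orbitFinset x ∪ σ.orbitFinset y)
      ((σ.orbits.erase (σ.orbitFinset x)).erase (σ.orbitFinset y)) := by
  ext s
  simp only [orbits, Finset.mem_image, Finset.mem_univ, true_and, Finset.mem_insert,
    Finset.mem_erase, orbitFinset_mul_swap hxy]
  constructor
  · rintro ⟨z, rfl⟩
    split_ifs with h
    · exact Or.inl rfl
    · refine Or.inr ⟨?_, ?_, z, rfl⟩ <;> rw [Ne, orbitFinset_eq_iff, sameCycle_comm] <;> tauto
  · rintro (rfl | ⟨hy, hx, z, rfl⟩)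
    · exact ⟨x, if_pos (Or.inl (SameCycle.refl _ _))⟩
    · refine ⟨z, if_neg ?_⟩
      rw [Ne, orbitFinset_eq_iff, sameCycle_comm] at hx hy
      tauto

theorem union_orbitFinset_notMem_orbits {σ : Perm α} {x y : α} (hxy : ¬ σ.SameCycle x y) :
    σ.orbitFinset x ∪ σ.orbitFinset y ∉ σ.orbits := by
  simp only [orbits, Finset.mem_image, Finset.mem_univ, true_and, not_exists]
  intro z hz
  have hx : σ.SameCycle z x := by rw [← mem_orbitFinset, hz]; simp [SameCycle.refl]
  have hy : σ.SameCycle z y := by rw [← mem_orbitFinset, hz]; simp [SameCycle.refl]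
  exact hxy (hx.symm.trans hy)

theorem orbitFinset_mem_orbits (σ : Perm α) (x : α) : σ.orbitFinset x ∈ σ.orbits :=
  Finset.mem_image_of_mem _ (Finset.mem_univ _)

theorem orbitFinset_mem_erase {σ : Perm α} {x y : α} (hxy : ¬ σ.SameCycle x y) :
    σ.orbitFinset y ∈ σ.orbits.erase (σ.orbitFinset x) := by
  rw [Finset.mem_erase, Ne, orbitFinset_eq_iff, sameCycle_comm]
  exact ⟨hxy, orbitFinset_mem_orbits σ y⟩

theorem card_orbits_mul_swap {σ : Perm α} {x y : α} (hxy : ¬ σ.SameCycle x y) :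
    (σ * swap x y).orbits.card + 1 = σ.orbits.card := by
  rw [orbits_mul_swap hxy, Finset.card_insert_of_notMem,
    Finset.card_erase_add_one (orbitFinset_mem_erase hxy),
    Finset.card_erase_add_one (orbitFinset_mem_orbits σ x)]
  simp [union_orbitFinset_notMem_orbits hxy]

theorem prod_card_orbits_mul_swap {σ : Perm α} {x y : α} (hxy : ¬ σ.SameCycle x y) :
    (∏ s ∈ (σ * swap x y).orbits, (s.card : ℚ)) =
      (∏ s ∈ σ.orbits, (s.card : ℚ)) *
        (((σ.orbitFinset x).card : ℚ)⁻¹ + ((σ.orbitFinset y).card : ℚ)⁻¹) := by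
  have hdisj : _root_.Disjoint (σ.orbitFinset x) (σ.orbitFinset y) := by
    rw [Finset.disjoint_left]
    simp only [mem_orbitFinset]
    exact fun z hx hy => hxy (hx.trans hy.symm)
  have hx : ((σ.orbitFinset x).card : ℚ) ≠ 0 := by exact_mod_cast (card_orbitFinset_pos σ x).ne'
  have hy : ((σ.orbitFinset y).card : ℚ) ≠ 0 := by exact_mod_cast (card_orbitFinset_pos σ y).ne'
  rw [orbits_mul_swap hxy, Finset.prod_insert (by simp [union_orbitFinset_notMem_orbits hxy]),
    Finset.card_union_of_disjoint hdisj,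
    ← Finset.mul_prod_erase _ _ (orbitFinset_mem_orbits σ x),
    ← Finset.mul_prod_erase _ _ (orbitFinset_mem_erase hxy)]
  field_simp
  push_cast
  ring

theorem card_orbits_le_mul_isSwap_add_one (σ : Perm α) {τ : Perm α} (hτ : τ.IsSwap) :
    σ.orbits.card ≤ (σ * τ).orbits.card + 1 := by
  obtain ⟨x, y, -, rfl⟩ := hτ
  by_cases hxy : σ.SameCycle x y
  · exact (card_orbits_le_card_orbits fun _ _ => hxy.of_mul_swap).trans (Nat.le_succ _)
  · exact (card_orbits_mul_swap hxy).ge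

theorem card_orbits_eq_one [Nonempty α] {σ : Perm α} (h : ∀ x y, σ.SameCycle x y) :
    σ.orbits.card = 1 := by
  have : σ.orbitFinset = fun _ => Finset.univ := by
    ext x y
    simp [h]
  simp [orbits, this, Finset.image_const]

theorem sameCycle_of_card_orbits_eq_one {σ : Perm α} (h : σ.orbits.card = 1) (x y : α) :
    σ.SameCycle x y :=
  orbitFinset_eq_iff.1 <| Finset.card_le_one.1 h.le _ (orbitFinset_mem_orbits σ x) _
    (orbitFinset_mem_orbits σ y)

theorem prod_card_orbits_of_card_eq_one {σ : Perm α} (h : σ.orbits.card = 1) :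
    ∏ s ∈ σ.orbits, (s.card : ℚ) = Fintype.card α := by
  obtain ⟨s, hs⟩ := Finset.card_eq_one.1 h
  have hsu : s = Finset.univ := by
    obtain ⟨x, -, rfl⟩ := Finset.mem_image.1 (hs ▸ Finset.mem_singleton_self s : s ∈ σ.orbits)
    ext y
    simp [sameCycle_of_card_orbits_eq_one h x y]
  rw [hs, Finset.prod_singleton, hsu, Finset.card_univ]

theorem orbitFinset_one (x : α) : (1 : Perm α).orbitFinset x = {x} := by
  ext y
  simp [eq_comm]

theorem card_orbits_one : (1 : Perm α).orbits.card = Fintype.card α := by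
  have h := sum_inv_card_orbitFinset (1 : Perm α)
  simp only [orbitFinset_one, Finset.card_singleton, Nat.cast_one, inv_one, Finset.sum_const,
    Finset.card_univ, nsmul_eq_mul, mul_one] at h
  exact_mod_cast h.symm

theorem prod_card_orbits_one : ∏ s ∈ (1 : Perm α).orbits, (s.card : ℚ) = 1 := by
  refine Finset.prod_eq_one fun s hs => ?_
  obtain ⟨x, -, rfl⟩ := Finset.mem_image.1 hs
  simp [orbitFinset_one]

theorem card_filter_swap_eq {τ : Perm α} (hτ : τ.IsSwap) :
    ({p : α × α | p.1 ≠ p.2 ∧ swap p.1 p.2 = τ} : Finset (α × α)).card = 2 := by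
  obtain ⟨a, b, hab, rfl⟩ := hτ
  have : ({p : α × α | p.1 ≠ p.2 ∧ swap p.1 p.2 = swap a b} : Finset (α × α)) =
      {(a, b), (b, a)} := by
    ext ⟨x, y⟩
    simp only [Finset.mem_filter, Finset.mem_univ, true_and, Finset.mem_insert,
      Finset.mem_singleton, Prod.mk.injEq]
    constructor
    · rintro ⟨hxy, h⟩
      have hs := congrArg support h
      rw [support_swap hxy, support_swap hab] at hs
      have hx : x ∈ ({a, b} : Finset α) := hs ▸ by simp
      have hy : y ∈ ({a, b} : Finset α) := hs ▸ by simp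
      simp only [Finset.mem_insert, Finset.mem_singleton] at hx hy
      grind
    · rintro (⟨rfl, rfl⟩ | ⟨rfl, rfl⟩)
      · exact ⟨hab, rfl⟩
      · exact ⟨hab.symm, swap_comm _ _⟩
  rw [this, Finset.card_pair (by simp [hab])]

open Classical in
theorem two_mul_sum_isSwap (f : Perm α → ℚ) :
    2 * ∑ τ : Perm α with τ.IsSwap, f τ =
      ∑ p : α × α with p.1 ≠ p.2, f (swap p.1 p.2) := by
  rw [← Finset.sum_fiberwise_of_maps_to (t := {τ : Perm α | τ.IsSwap})
    (g := fun p : α × α => swap p.1 p.2), Finset.mul_sum]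
  · refine Finset.sum_congr rfl fun τ hτ => ?_
    rw [Finset.filter_filter, Finset.sum_congr rfl (g := fun _ => f τ), Finset.sum_const,
      nsmul_eq_mul]
    · congr 1
      have := card_filter_swap_eq (Finset.mem_filter.1 hτ).2
      exact_mod_cast this.symm.trans (by congr!)
    · intro p hp
      rw [(Finset.mem_filter.1 hp).2.2]
  · intro p hp
    simp only [Finset.mem_filter, Finset.mem_univ, true_and] at hp ⊢
    exact ⟨_, _, hp, rfl⟩

theorem sum_inv_card_orbitFinset_of_not_sameCycle (σ : Perm α) :
    ∑ p : α × α with ¬ σ.SameCycle p.1 p.2, ((σ.orbitFinset p.1).card : ℚ)⁻¹ =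
      Fintype.card α * (σ.orbits.card - 1) := by
  have h (x : α) : ∑ y with ¬ σ.SameCycle x y, ((σ.orbitFinset x).card : ℚ)⁻¹ =
      Fintype.card α * ((σ.orbitFinset x).card : ℚ)⁻¹ - 1 := by
    have hc : ({y | ¬ σ.SameCycle x y} : Finset α) = (σ.orbitFinset x)ᶜ := by
      ext y
      simp
    have hx : ((σ.orbitFinset x).card : ℚ) ≠ 0 := by
      exact_mod_cast (card_orbitFinset_pos σ x).ne'
    rw [hc, Finset.sum_const, Finset.card_compl, nsmul_eq_mul,
      Nat.cast_sub (Finset.card_le_univ _), sub_mul, mul_inv_cancel₀ hx]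
  rw [Finset.sum_filter, Fintype.sum_prod_type]
  simp_rw [← Finset.sum_filter, h]
  rw [Finset.sum_sub_distrib, ← Finset.mul_sum, sum_inv_card_orbitFinset, mul_sub]
  simp

end Equiv.Perm

open Equiv

theorem finite_swapFactorizations (n r : ℕ) (π : Perm (Fin n)) :
    Finite {l : List (Perm (Fin n)) // l.length = r ∧ (∀ τ ∈ l, τ.IsSwap) ∧ l.prod = π} :=
  ((List.finite_length_eq (Perm (Fin n)) r).subset fun _ h => h.1).to_subtype

theorem swapFactorizationCount_zero (n : ℕ) (π : Perm (Fin n)) :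
    swapFactorizationCount n 0 π = if π = 1 then 1 else 0 := by
  unfold swapFactorizationCount
  split_ifs with h
  · rw [Nat.card_eq_one_iff_unique]
    refine ⟨⟨?_⟩, ⟨⟨[], rfl, by simp, by simp [h]⟩⟩⟩
    rintro ⟨l, hl, -⟩ ⟨l', hl', -⟩
    simp only [Subtype.mk.injEq]
    rw [List.length_eq_zero_iff.1 hl, List.length_eq_zero_iff.1 hl']
  · have : IsEmpty {l : List (Perm (Fin n)) //
        l.length = 0 ∧ (∀ τ ∈ l, τ.IsSwap) ∧ l.prod = π} := by
      refine ⟨?_⟩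
      rintro ⟨l, hl, -, hp⟩
      rw [List.length_eq_zero_iff.1 hl, List.prod_nil] at hp
      exact h hp.symm
    exact Nat.card_of_isEmpty

/-- Splitting off the first transposition of a factorization. -/
def swapFactorizationsSuccEquiv (n r : ℕ) (π : Perm (Fin n)) :
    {l : List (Perm (Fin n)) // l.length = r + 1 ∧ (∀ τ ∈ l, τ.IsSwap) ∧ l.prod = π} ≃
      Σ τ : {τ : Perm (Fin n) // τ.IsSwap}, {l : List (Perm (Fin n)) //
        l.length = r ∧ (∀ τ ∈ l, τ.IsSwap) ∧ l.prod = τ.1⁻¹ * π} where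
  toFun
    | ⟨τ :: l, h⟩ => ⟨⟨τ, h.2.1 τ (by simp)⟩, l, by simpa using h.1,
        fun ρ hρ => h.2.1 ρ (by simp [hρ]), by simp [← h.2.2]⟩
  invFun p := ⟨p.1 :: p.2.1, by simp [p.2.2.1], by
    simpa using ⟨p.1.2, p.2.2.2.1⟩, by simp [p.2.2.2.2]⟩
  left_inv := by
    rintro ⟨_ | ⟨τ, l⟩, h⟩
    · simp at h
    · rfl
  right_inv := by
    rintro ⟨⟨τ, hτ⟩, l, hl⟩
    rfl

open Classical in
theorem swapFactorizationCount_succ (n r : ℕ) (π : Perm (Fin n)) :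
    swapFactorizationCount n (r + 1) π =
      ∑ τ : Perm (Fin n) with τ.IsSwap, swapFactorizationCount n r (τ⁻¹ * π) := by
  have (τ : Perm (Fin n)) := finite_swapFactorizations n r (τ⁻¹ * π)
  unfold swapFactorizationCount
  rw [Nat.card_congr (swapFactorizationsSuccEquiv n r π), Nat.card_sigma]
  exact (Finset.sum_subtype _ (by simp) fun τ : Perm (Fin n) => Nat.card {l : List (Perm (Fin n)) //
    l.length = r ∧ (∀ τ ∈ l, τ.IsSwap) ∧ l.prod = τ⁻¹ * π}).symm

theorem swapFactorizationCount_conj (n r : ℕ) (g π : Perm (Fin n)) :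
    swapFactorizationCount n r (g * π * g⁻¹) = swapFactorizationCount n r π := by
  induction r generalizing π with
  | zero => simp [swapFactorizationCount_zero]
  | succ r ih =>
    classical
    rw [swapFactorizationCount_succ, swapFactorizationCount_succ]
    symm
    refine Finset.sum_equiv (MulAut.conj g).toEquiv (fun τ => ?_) fun τ _ => ?_
    · simp only [Finset.mem_filter, Finset.mem_univ, true_and, ← Perm.card_support_eq_two]
      simp
    · rw [← ih]
      congr 1
      simp [mul_assoc]

/-- The number of sequences of `r` transpositions which turn `σ`, by multiplication on the right,
into a permutation with a single cycle. -/
def joiningSwapsCount (n r : ℕ) (σ : Perm (Fin n)) : ℕ :=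
  ∑ ρ : Perm (Fin n) with ρ.orbits.card = 1, swapFactorizationCount n r (σ⁻¹ * ρ)

theorem joiningSwapsCount_zero (n : ℕ) (σ : Perm (Fin n)) :
    joiningSwapsCount n 0 σ = if σ.orbits.card = 1 then 1 else 0 := by
  simp [joiningSwapsCount, swapFactorizationCount_zero, inv_mul_eq_one, Finset.sum_ite_eq]

open Classical in
theorem joiningSwapsCount_succ (n r : ℕ) (σ : Perm (Fin n)) :
    joiningSwapsCount n (r + 1) σ =
      ∑ τ : Perm (Fin n) with τ.IsSwap, joiningSwapsCount n r (σ * τ) := by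
  simp only [joiningSwapsCount, swapFactorizationCount_succ, mul_inv_rev, mul_assoc]
  exact Finset.sum_comm

theorem joiningSwapsCount_eq_zero {n r : ℕ} {σ : Perm (Fin n)} (h : r + 1 < σ.orbits.card) :
    joiningSwapsCount n r σ = 0 := by
  induction r generalizing σ with
  | zero => rw [joiningSwapsCount_zero, if_neg (by omega)]
  | succ r ih =>
    classical
    rw [joiningSwapsCount_succ]
    refine Finset.sum_eq_zero fun τ hτ => ih ?_
    have := σ.card_orbits_le_mul_isSwap_add_one (Finset.mem_filter.1 hτ).2
    omega

theorem mul_joiningSwapsCount {n r : ℕ} {σ : Perm (Fin n)} (h : σ.orbits.card = r + 1) :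
    (n : ℚ) * joiningSwapsCount n r σ = r.factorial * n ^ r * ∏ s ∈ σ.orbits, (s.card : ℚ) := by
  induction r generalizing σ with
  | zero => simp [joiningSwapsCount_zero, h, Perm.prod_card_orbits_of_card_eq_one h]
  | succ r ih =>
    classical
    refine mul_left_cancel₀ (two_ne_zero (α := ℚ)) ?_
    set P := ∏ s ∈ σ.orbits, (s.card : ℚ) with hP
    have hterm (p : Fin n × Fin n) : (if p.1 ≠ p.2 then
        (n : ℚ) * joiningSwapsCount n r (σ * swap p.1 p.2) else 0) =
        if ¬ σ.SameCycle p.1 p.2 then r.factorial * n ^ r * P *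
          (((σ.orbitFinset p.1).card : ℚ)⁻¹ + ((σ.orbitFinset p.2).card : ℚ)⁻¹) else 0 := by
      by_cases hs : σ.SameCycle p.1 p.2
      · have := Perm.card_orbits_le_card_orbits fun a b (hab : (σ * swap p.1 p.2).SameCycle a b) =>
          hs.of_mul_swap hab
        rw [joiningSwapsCount_eq_zero (by omega)]
        simp [hs]
      · have hne : p.1 ≠ p.2 := fun h => hs (h ▸ Perm.SameCycle.refl _ _)
        have := Perm.card_orbits_mul_swap hs
        rw [if_pos hne, if_pos hs, ih (by omega), Perm.prod_card_orbits_mul_swap hs, mul_assoc]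
        ring
    have hsymm : ∑ p : Fin n × Fin n with ¬ σ.SameCycle p.1 p.2,
        ((σ.orbitFinset p.2).card : ℚ)⁻¹ = ∑ p : Fin n × Fin n with ¬ σ.SameCycle p.1 p.2,
        ((σ.orbitFinset p.1).card : ℚ)⁻¹ :=
      Finset.sum_equiv (Equiv.prodComm _ _) (by simp [Perm.sameCycle_comm]) (by simp)
    calc 2 * ((n : ℚ) * joiningSwapsCount n (r + 1) σ)
        = 2 * ∑ τ : Perm (Fin n) with τ.IsSwap, (n : ℚ) * joiningSwapsCount n r (σ * τ) := by
          rw [joiningSwapsCount_succ, Nat.cast_sum, Finset.mul_sum]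
      _ = ∑ p : Fin n × Fin n with ¬ σ.SameCycle p.1 p.2, r.factorial * n ^ r * P *
          (((σ.orbitFinset p.1).card : ℚ)⁻¹ + ((σ.orbitFinset p.2).card : ℚ)⁻¹) := by
          rw [Perm.two_mul_sum_isSwap, Finset.sum_filter, Finset.sum_filter]
          exact Finset.sum_congr rfl fun p _ => hterm p
      _ = 2 * ((r + 1).factorial * n ^ (r + 1) * P) := by
          rw [← Finset.mul_sum, Finset.sum_add_distrib, hsymm,
            Perm.sum_inv_card_orbitFinset_of_not_sameCycle, h, Fintype.card_fin,
            Nat.factorial_succ]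
          push_cast
          ring

theorem cycleType_eq_singleton_iff_card_orbits_eq_one {n : ℕ} (hn : 2 ≤ n) {π : Perm (Fin n)} :
    π.cycleType = {n} ↔ π.orbits.card = 1 := by
  have : NeZero n := ⟨by omega⟩
  have : Nontrivial (Fin n) := Fin.nontrivial_iff_two_le.2 hn
  constructor
  · intro h
    have hc : π.IsCycle := Perm.card_cycleType_eq_one.1 (by simp [h])
    have hs : π.support = Finset.univ := by
      rw [← Finset.card_eq_iff_eq_univ, ← Perm.sum_cycleType, h]
      simp
    have hmoved (x : Fin n) : π x ≠ x := Perm.mem_support.1 (hs ▸ Finset.mem_univ x)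
    exact Perm.card_orbits_eq_one fun x y => hc.sameCycle (hmoved x) (hmoved y)
  · intro h
    have hsame := Perm.sameCycle_of_card_orbits_eq_one h
    have hmoved (x : Fin n) : π x ≠ x := fun hx => by
      obtain ⟨y, hy⟩ := exists_ne x
      exact hy ((hsame x y).eq_of_left hx).symm
    have hc : π.IsCycle := ⟨0, hmoved 0, fun y _ => hsame 0 y⟩
    have hs : π.support = Finset.univ := by
      ext x
      simpa using hmoved x
    rw [hc.cycleType, hs, Finset.card_univ, Fintype.card_fin]

theorem cycleType_eq_singleton_of_fullCycleType {n : ℕ} (hn : 2 ≤ n) {π : Perm (Fin n)}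
    (hπ : fullCycleType π = {n}) : π.cycleType = {n} := by
  have hmem : n ∈ fullCycleType π := by simp [hπ]
  rw [fullCycleType, Multiset.mem_add] at hmem
  have hmem' : n ∈ π.cycleType := hmem.resolve_right fun h => by
    have := Multiset.eq_of_mem_replicate h
    omega
  have hle : {n} ≤ π.cycleType := Multiset.singleton_le.2 hmem'
  exact le_antisymm (hπ ▸ Multiset.le_add_right _ _) hle

/-- Dénes/Hurwitz. The number of factorizations of a single `n`-cycle in `S_n`
into the minimal number `n - 1` of transpositions equals `n^(n-2)`. -/
theorem swapFactorizationCount_cycle (n : ℕ) (hn : 1 ≤ n) (π : Equiv.Perm (Fin n))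
    (hπ : fullCycleType π = {n}) :
    swapFactorizationCount n (n - 1) π = n ^ (n - 2) := by
  obtain rfl | hn2 := hn.eq_or_lt
  · rw [swapFactorizationCount_zero, if_pos (Subsingleton.elim _ _), one_pow]
  have hn2 : 2 ≤ n := hn2
  have hcycle := cycleType_eq_singleton_of_fullCycleType hn2 hπ
  have htotal : joiningSwapsCount n (n - 1) 1 =
      (n - 1).factorial * swapFactorizationCount n (n - 1) π := by
    have hconst : ∀ ρ ∈ ({ρ | ρ.orbits.card = 1} : Finset (Perm (Fin n))),
        swapFactorizationCount n (n - 1) (1⁻¹ * ρ) = swapFactorizationCount n (n - 1) π := by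
      intro ρ hρ
      rw [Finset.mem_filter, ← cycleType_eq_singleton_iff_card_orbits_eq_one hn2] at hρ
      obtain ⟨g, rfl⟩ := isConj_iff.1 (Perm.isConj_iff_cycleType_eq.2 (hcycle.trans hρ.2.symm))
      rw [inv_one, one_mul, swapFactorizationCount_conj]
    have hcard := Perm.card_of_cycleType_singleton (α := Fin n) hn2 (by simp)
    simp only [cycleType_eq_singleton_iff_card_orbits_eq_one hn2, Fintype.card_fin,
      Nat.choose_self, mul_one] at hcard
    rw [joiningSwapsCount, Finset.sum_congr rfl hconst, Finset.sum_const, hcard, smul_eq_mul]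
  have hmul := mul_joiningSwapsCount (n := n) (r := n - 1) (σ := 1)
    (by rw [Perm.card_orbits_one, Fintype.card_fin]; omega)
  rw [Perm.prod_card_orbits_one, mul_one, htotal] at hmul
  have hmul : n * ((n - 1).factorial * swapFactorizationCount n (n - 1) π) =
      (n - 1).factorial * n ^ (n - 1) := by exact_mod_cast hmul
  have hpow : n ^ (n - 1) = n * n ^ (n - 2) := by
    rw [← pow_succ']
    congr 1
    omega
  rw [hpow, mul_left_comm] at hmul
  exact Nat.eq_of_mul_eq_mul_left (by omega)
    (Nat.eq_of_mul_eq_mul_left (Nat.factorial_pos _) hmul)
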